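/- arXiv:1310.8505 — 2 statements merged into one kernel-verified Lean document; each statement's English description precedes it below -/
import Mathlib

section
/- Let n ≥ 1 and let x₀, x₁, …, xₙ ∈ ℝⁿ be affinely independent points, and let Δ = conv{x₀, …, xₙ} be the n-simplex they span. If P and Q are nonempty compact convex subsets of ℝⁿ with P + Q = Δ (Minkowski sum), then there exist t ∈ [0,1] and vectors v, w ∈ ℝⁿ such that P = v + t • Δ and Q = w + (1 - t) • Δ. In other words, every n-simplex in ℝⁿ is Minkowski indecomposable: its only Minkowski summands are translated homothets of itself. -/
open scoped Pointwise

theorem summand_aux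
    (n : ℕ) (hn : 1 ≤ n)
    (b : AffineBasis (Fin (n + 1)) ℝ (EuclideanSpace ℝ (Fin n)))
    (P Q : Set (EuclideanSpace ℝ (Fin n)))
    (hPconv : Convex ℝ P)
    (hsum : P + Q = convexHull ℝ (Set.range b))
    (p q : Fin (n + 1) → EuclideanSpace ℝ (Fin n))
    (hp : ∀ j, p j ∈ P) (hq : ∀ j, q j ∈ Q) (hpq : ∀ j, p j + q j = b j) :
    ∃ t : ℝ, 0 ≤ t ∧ ∃ v : EuclideanSpace ℝ (Fin n), (∀ j, p j = v + t • b j) ∧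
      P = v +ᵥ t • (convexHull ℝ (Set.range b)) := by
  set L : Fin (n + 1) → (EuclideanSpace ℝ (Fin n) →ₗ[ℝ] ℝ) := fun i => (b.coord i).linear with hL
  have hc : ∀ i a, b.coord i a = L i a + b.coord i 0 := by
    intro i a
    have := congrFun (AffineMap.decomp (b.coord i)) a
    exact this
  have hLsum : ∀ a, ∑ i, L i a = 0 := by
    intro a
    have h1 := b.sum_coord_apply_eq_one a
    have h0 := b.sum_coord_apply_eq_one (0 : EuclideanSpace ℝ (Fin n))
    rw [Finset.sum_congr rfl (fun i _ => hc i a), Finset.sum_add_distrib, h0] at h1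
    linarith
  have hLext : ∀ a a', (∀ i, L i a = L i a') → a = a' := by
    intro a a' h
    apply b.ext_elem
    intro i
    rw [hc i a, hc i a', h i]
  have hnn : ∀ a ∈ P, ∀ a' ∈ Q, ∀ i, 0 ≤ b.coord i (a + a') := by
    intro a ha a' ha' i
    have : a + a' ∈ convexHull ℝ (Set.range b) := hsum ▸ Set.add_mem_add ha ha'
    rw [b.convexHull_eq_nonneg_coord] at this
    exact this i
  have hmin : ∀ i j, j ≠ i → ∀ a ∈ P, L i (p j) ≤ L i a := by
    intro i j hij a ha
    have h1 := hnn a ha (q j) (hq j) i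
    have h2 : b.coord i (p j + q j) = 0 := by
      rw [hpq j]; exact b.coord_apply_ne hij.symm
    rw [hc, map_add] at h1 h2
    linarith
  have hex : ∀ i : Fin (n + 1), ∃ j, j ≠ i := by
    intro i
    have : Nontrivial (Fin (n + 1)) := Fin.nontrivial_iff_two_le.2 (by omega)
    exact exists_ne i
  choose s hs using hex
  set m : Fin (n + 1) → ℝ := fun i => L i (p (s i)) with hm
  have hle : ∀ i, ∀ a ∈ P, m i ≤ L i a := fun i a ha => hmin i (s i) (hs i) a ha
  have heq : ∀ i j, j ≠ i → L i (p j) = m i := fun i j hij =>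
    le_antisymm (hmin i j hij _ (hp _)) (hle i _ (hp j))
  set t : ℝ := - ∑ i, m i with ht
  have hdiag : ∀ j, L j (p j) = m j + t := by
    intro j
    have h1 := hLsum (p j)
    rw [← Finset.add_sum_erase _ _ (Finset.mem_univ j)] at h1
    rw [Finset.sum_congr rfl (fun i hi => heq i j (Finset.ne_of_mem_erase hi).symm)] at h1
    rw [ht, ← Finset.add_sum_erase _ _ (Finset.mem_univ j)]
    linarith
  have ht0 : 0 ≤ t := by
    have := hle 0 _ (hp 0)
    rw [hdiag] at this
    linarith
  have hLp : ∀ i j, L i (p j - t • b j) = m i + t * b.coord i 0 := by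
    intro i j
    have h1 := hc i (b j)
    rw [map_sub, map_smul, smul_eq_mul]
    by_cases hij : j = i
    · subst hij
      rw [b.coord_apply_eq] at h1
      rw [hdiag, show L j (b j) = 1 - b.coord j 0 by linarith]; ring
    · rw [b.coord_apply_ne (Ne.symm hij)] at h1
      rw [heq i j hij, show L i (b j) = - b.coord i 0 by linarith]; ring
  set v := p 0 - t • b 0 with hv
  have hpv : ∀ j, p j = v + t • b j := by
    intro j
    have : p j - t • b j = v := hLext _ _ (fun i => by rw [hLp, hv, hLp])
    rw [← this]; abel
  refine ⟨t, ht0, v, hpv, ?_⟩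
  apply Set.Subset.antisymm
  · intro a ha
    have hLa : ∀ i, 0 ≤ L i (a - v) + t * b.coord i 0 := by
      intro i
      have := hle i a ha
      rw [map_sub, hv, hLp]; linarith
    rw [Set.mem_vadd_set]
    refine ⟨a - v, ?_, by simp⟩
    rcases ht0.eq_or_lt with h0 | h0
    · rw [← h0] at hLa ⊢
      have hz : a - v = 0 := by
        apply hLext
        intro i
        rw [map_zero]
        exact (Finset.sum_eq_zero_iff_of_nonneg (fun i _ => by simpa using hLa i)).1
          (hLsum (a - v)) i (Finset.mem_univ i)
      rw [hz, Set.zero_smul_set (Set.range_nonempty b).convexHull]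
      rfl
    · rw [Set.mem_smul_set_iff_inv_smul_mem₀ h0.ne', b.convexHull_eq_nonneg_coord]
      intro i
      rw [hc, map_smul, smul_eq_mul]
      have : t⁻¹ * L i (a - v) + b.coord i 0 = t⁻¹ * (L i (a - v) + t * b.coord i 0) := by
        field_simp
      rw [this]
      exact mul_nonneg (inv_nonneg.2 ht0) (hLa i)
  · rw [← convexHull_smul, ← convexHull_vadd]
    apply convexHull_min _ hPconv
    rintro _ ⟨_, ⟨_, ⟨j, rfl⟩, rfl⟩, rfl⟩
    have := hp j
    rw [hpv j] at this
    exact this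

/-- Every `n`-simplex in `ℝⁿ` is Minkowski indecomposable: if nonempty compact convex
sets `P` and `Q` satisfy `P + Q = Δ` for a simplex `Δ` spanned by affinely independent
points `x₀, …, xₙ`, then `P` and `Q` are translated homothets of `Δ`. -/
theorem simplex_minkowski_indecomposable
    (n : ℕ) (hn : 1 ≤ n)
    (x : Fin (n + 1) → EuclideanSpace ℝ (Fin n))
    (hx : AffineIndependent ℝ x)
    (P Q : Set (EuclideanSpace ℝ (Fin n)))
    (hPne : P.Nonempty) (hQne : Q.Nonempty)
    (hPc : IsCompact P) (hQc : IsCompact Q)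
    (hPconv : Convex ℝ P) (hQconv : Convex ℝ Q)
    (hsum : P + Q = convexHull ℝ (Set.range x)) :
    ∃ t ∈ Set.Icc (0 : ℝ) 1, ∃ v w : EuclideanSpace ℝ (Fin n),
      P = v +ᵥ t • (convexHull ℝ (Set.range x)) ∧
      Q = w +ᵥ (1 - t) • (convexHull ℝ (Set.range x)) := by
  have hspan : affineSpan ℝ (Set.range x) = ⊤ := by
    rw [hx.affineSpan_eq_top_iff_card_eq_finrank_add_one]
    simp
  let b : AffineBasis (Fin (n + 1)) ℝ (EuclideanSpace ℝ (Fin n)) := ⟨x, hx, hspan⟩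
  have hmem : ∀ j, ∃ p ∈ P, ∃ q ∈ Q, p + q = x j := by
    intro j
    have : x j ∈ P + Q := hsum ▸ subset_convexHull ℝ _ ⟨j, rfl⟩
    exact Set.mem_add.1 this
  choose p hp q hq hpq using hmem
  obtain ⟨t, ht, v, hpv, hP⟩ := summand_aux n hn b P Q hPconv hsum p q hp hq hpq
  obtain ⟨t', ht', w, hqw, hQ⟩ := summand_aux n hn b Q P hQconv (by rw [add_comm]; exact hsum)
    q p hq hp (fun j => by rw [add_comm]; exact hpq j)
  have hbx : ∀ j, b j = x j := fun _ => rfl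
  have htt : t' = 1 - t := by
    have h (j) : v + w + (t + t' - 1) • x j = 0 := by
      have := hpq j
      rw [hpv, hqw, hbx] at this
      calc _ = (v + t • x j + (w + t' • x j)) - x j := by module
        _ = 0 := by rw [this, sub_self]
    have : Nontrivial (Fin (n + 1)) := Fin.nontrivial_iff_two_le.2 (by omega)
    obtain ⟨j, hj⟩ := exists_ne (0 : Fin (n + 1))
    have h2 : (t + t' - 1) • (x j - x 0) = 0 := by
      rw [smul_sub, sub_eq_zero]
      exact add_left_cancel ((h j).trans (h 0).symm)
    rcases smul_eq_zero.1 h2 with h3 | h3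
    · linarith
    · exact absurd (hx.injective (sub_eq_zero.1 h3)) hj
  subst htt
  exact ⟨t, ⟨ht, by linarith⟩, v, w, hP, hQ⟩
end

section
/- Let v₁, …, vₙ be a basis of ℝⁿ and let ρ = d₁ v₁ + ⋯ + dₙ vₙ ∈ ℝⁿ. Then the set {x ∈ ℝⁿ | ⟨x, vᵢ⟩ ≥ 0 for all i, and ⟨x, ρ⟩ ≥ −1} is bounded if and only if dᵢ < 0 for all i = 1, …, n. -/
open scoped RealInnerProductSpace

/-- For a basis `v₁, …, vₙ` of `ℝⁿ` and `ρ = d₁v₁ + ⋯ + dₙvₙ`, the region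
`{x | ⟪x, vᵢ⟫ ≥ 0 ∀ i, ⟪x, ρ⟫ ≥ −1}` is bounded if and only if all `dᵢ < 0`. -/
theorem dual_cone_inter_halfspace_bounded_iff
    (n : ℕ) (v : Fin n → EuclideanSpace ℝ (Fin n))
    (hv_indep : LinearIndependent ℝ v)
    (hv_span : Submodule.span ℝ (Set.range v) = ⊤)
    (d : Fin n → ℝ)
    (ρ : EuclideanSpace ℝ (Fin n)) (hρ : ρ = ∑ i, d i • v i) :
    Bornology.IsBounded
        {x : EuclideanSpace ℝ (Fin n) | (∀ i, 0 ≤ ⟪x, v i⟫) ∧ -1 ≤ ⟪x, ρ⟫} ↔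
      ∀ i, d i < 0 := by
  have hinner : ∀ x : EuclideanSpace ℝ (Fin n), ⟪x, ρ⟫ = ∑ i, d i * ⟪x, v i⟫ := by
    intro x
    rw [hρ, inner_sum]
    simp [inner_smul_right]
  let L : EuclideanSpace ℝ (Fin n) →ₗ[ℝ] (Fin n → ℝ) :=
    LinearMap.pi fun i => (innerₗ (EuclideanSpace ℝ (Fin n))) (v i)
  have hL : ∀ x i, L x i = ⟪x, v i⟫ := by
    intro x i
    simp [L, real_inner_comm]
  have hinj : Function.Injective L := by
    rw [injective_iff_map_eq_zero]
    intro x hx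
    have h1 : ∀ y ∈ Submodule.span ℝ (Set.range v), ⟪x, y⟫ = 0 := by
      intro y hy
      induction hy using Submodule.span_induction with
      | mem y hy =>
        obtain ⟨i, rfl⟩ := hy
        rw [← hL, hx]; rfl
      | zero => simp
      | add a b _ _ ha hb => rw [inner_add_right, ha, hb, add_zero]
      | smul c a _ ha => rw [inner_smul_right, ha, mul_zero]
    have := h1 x (by rw [hv_span]; trivial)
    exact inner_self_eq_zero.mp this
  let e := LinearEquiv.ofInjectiveOfFinrankEq L hinj (by simp)
  have he : ∀ x i, e x i = ⟪x, v i⟫ := fun x i => hL x i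
  constructor
  · intro hb j
    by_contra! hj
    obtain ⟨C, hC⟩ := hb.exists_norm_le
    set w := e.symm (Pi.single j 1) with hw
    have hwv : ∀ i, ⟪w, v i⟫ = (Pi.single j (1 : ℝ) : Fin n → ℝ) i := by
      intro i
      rw [← he, hw, LinearEquiv.apply_symm_apply]
    have hw0 : w ≠ 0 := by
      intro h
      have := hwv j
      simp [h] at this
    have hpos : 0 < ‖w‖ := norm_pos_iff.mpr hw0
    have hwn : ∀ i, 0 ≤ ⟪w, v i⟫ := by
      intro i
      rw [hwv, Pi.single_apply]
      split_ifs <;> norm_num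
    have hwρ : ⟪w, ρ⟫ = d j := by
      rw [hinner]
      simp [hwv, Pi.single_apply]
    have ht : 0 ≤ (|C| + 1) / ‖w‖ := by positivity
    have := hC (((|C| + 1) / ‖w‖) • w) ⟨fun i => by
      rw [real_inner_smul_left]; exact mul_nonneg ht (hwn i), by
      rw [real_inner_smul_left, hwρ]
      linarith [mul_nonneg ht hj]⟩
    rw [norm_smul, Real.norm_of_nonneg ht, div_mul_cancel₀ _ hpos.ne'] at this
    linarith [le_abs_self C]
  · intro hd
    have hK : IsCompact (Set.Icc (0 : Fin n → ℝ) (fun i => -1 / d i)) := isCompact_Icc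
    have hc : Continuous e.symm := e.symm.toLinearMap.continuous_of_finiteDimensional
    refine (hK.image hc).isBounded.subset ?_
    rintro x ⟨hx, hxρ⟩
    refine ⟨e x, ⟨fun i => ?_, fun i => ?_⟩, by simp⟩
    · rw [he]; exact hx i
    · change e x i ≤ -1 / d i
      rw [he, le_div_iff_of_neg (hd i)]
      rw [hinner] at hxρ
      have h2 : ∑ k, (-(d k * ⟪x, v k⟫)) ≤ 1 := by
        rw [Finset.sum_neg_distrib]; linarith
      have h3 := Finset.single_le_sum (f := fun k => -(d k * ⟪x, v k⟫))
        (fun k _ => by nlinarith [mul_nonneg (neg_nonneg.mpr (hd k).le) (hx k)])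
        (Finset.mem_univ i)
      linarith
end
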